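/- Let X be a finite subset of ℝ^n and k ≥ 0 an integer with |X| ≥ k+1. Suppose a, b ∈ Γ_k(X), a_0 is a maximal branch point below a, and b_0 is a maximal branch point below b. Then any least upper bound of a_0 and b_0 is a maximal branch point below any least upper bound of a and b. -/

import Mathlib

open scoped Classical

noncomputable section

namespace DataHomotopy

/-- Points of `ℝ^n` with the Euclidean metric. -/
abbrev Pt (n : ℕ) := EuclideanSpace ℝ (Fin n)

/-- `σ` is a simplex of the Vietoris–Rips complex `V_s(X)`: a nonempty subset of `X`
all of whose pairwise distances are at most `s`. -/
def IsVRSimplex {n : ℕ} (X : Finset (Pt n)) (s : ℝ) (σ : Finset (Pt n)) : Prop :=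
  σ.Nonempty ∧ σ ⊆ X ∧ ∀ x ∈ σ, ∀ y ∈ σ, dist x y ≤ s

/-- `x` is a vertex of the Lesnick complex `L_{s,k}(X)`: `x ∈ X` and there are at least
`k` points of `X`, distinct from `x`, within distance `s` of `x`. -/
def IsLVertex {n : ℕ} (X : Finset (Pt n)) (k : ℕ) (s : ℝ) (x : Pt n) : Prop :=
  x ∈ X ∧ ∃ S : Finset (Pt n), S ⊆ X ∧ x ∉ S ∧ k ≤ S.card ∧ ∀ x' ∈ S, dist x x' ≤ s

/-- `σ` is a simplex of the Lesnick complex `L_{s,k}(X)`: a Vietoris–Rips simplex all of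
whose elements are vertices of `L_{s,k}(X)`. -/
def IsLSimplex {n : ℕ} (X : Finset (Pt n)) (k : ℕ) (s : ℝ) (σ : Finset (Pt n)) : Prop :=
  IsVRSimplex X s σ ∧ ∀ x ∈ σ, IsLVertex X k s x

/-- `x` and `y` lie in the same component of `L_{s,k}(X)`: both are vertices, and they are
joined by a finite chain of vertices with consecutive distances at most `s`. -/
def SameComp {n : ℕ} (X : Finset (Pt n)) (k : ℕ) (s : ℝ) (x y : Pt n) : Prop :=
  IsLVertex X k s x ∧
    Relation.ReflTransGen (fun a b => IsLVertex X k s b ∧ dist a b ≤ s) x y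

/-- `p = (s, x)` is an element of `Γ_k(X)`: `s ≥ 0` and `x` is a vertex of `L_{s,k}(X)`. -/
def InGamma {n : ℕ} (X : Finset (Pt n)) (k : ℕ) (p : ℝ × Pt n) : Prop :=
  0 ≤ p.1 ∧ IsLVertex X k p.1 p.2

/-- The preorder on `Γ_k(X)`: `(s, x) ≼ (t, y)` iff `s ≤ t` and `x`, `y` lie in the same
component of `L_{t,k}(X)`. -/
def GammaLe {n : ℕ} (X : Finset (Pt n)) (k : ℕ) (p q : ℝ × Pt n) : Prop :=
  p.1 ≤ q.1 ∧ SameComp X k q.1 p.2 q.2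

/-- `p = (t, x)` is a branch point of `Γ_k(X)`. -/
def IsBranch {n : ℕ} (X : Finset (Pt n)) (k : ℕ) (p : ℝ × Pt n) : Prop :=
  InGamma X k p ∧
    ((∃ s₀, s₀ < p.1 ∧ ∀ s, s₀ ≤ s → s < p.1 →
        ∃ x₀ x₁ : Pt n, IsLVertex X k s x₀ ∧ IsLVertex X k s x₁ ∧
          ¬ SameComp X k s x₀ x₁ ∧ GammaLe X k (s, x₀) p ∧ GammaLe X k (s, x₁) p) ∨
      ¬ ∃ q : ℝ × Pt n, q.1 < p.1 ∧ InGamma X k q ∧ GammaLe X k q p)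

/-- `c` is a least upper bound of `a` and `b` in `Γ_k(X)`. -/
def IsLUBIn {n : ℕ} (X : Finset (Pt n)) (k : ℕ) (a b c : ℝ × Pt n) : Prop :=
  InGamma X k c ∧ GammaLe X k a c ∧ GammaLe X k b c ∧
    ∀ c', InGamma X k c' → GammaLe X k a c' → GammaLe X k b c' → GammaLe X k c c'

/-- `b` is a maximal branch point below `a` in `Γ_k(X)`. -/
def IsMaxBranchBelow {n : ℕ} (X : Finset (Pt n)) (k : ℕ) (b a : ℝ × Pt n) : Prop :=
  IsBranch X k b ∧ GammaLe X k b a ∧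
    ∀ b', IsBranch X k b' → GammaLe X k b' a → GammaLe X k b' b

/-- The Euclidean distance on `(ℝ^n)^m ≅ ℝ^{nm}` between two `m`-tuples. -/
def tupleDist {n m : ℕ} (y x : Fin m → Pt n) : ℝ :=
  Real.sqrt (∑ i, dist (y i) (x i) ^ 2)

/-- `X^m_dis` is `r`-dense in `Y^m_dis`: every `m`-tuple of pairwise distinct points of `Y`
is within distance `< r` (in `ℝ^{nm}`) of an `m`-tuple of pairwise distinct points of `X`. -/
def ConfigDense {n : ℕ} (X Y : Finset (Pt n)) (m : ℕ) (r : ℝ) : Prop :=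
  ∀ y : Fin m → Pt n, (∀ i, y i ∈ Y) → Function.Injective y →
    ∃ x : Fin m → Pt n, (∀ i, x i ∈ X) ∧ Function.Injective x ∧ tupleDist y x < r

/-- `s` and `t` are consecutive phase-change numbers of `Y`: both are realized as distances
between points of `Y`, `s < t`, and no distance between points of `Y` lies strictly
between `s` and `t`. -/
def IsPhasePair {n : ℕ} (Y : Finset (Pt n)) (s t : ℝ) : Prop :=
  (∃ a ∈ Y, ∃ b ∈ Y, dist a b = s) ∧ (∃ a ∈ Y, ∃ b ∈ Y, dist a b = t) ∧
    s < t ∧ ∀ a ∈ Y, ∀ b ∈ Y, dist a b ≤ s ∨ t ≤ dist a b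

/-- `dS X k s x y = u - s`, where `u` is the least number `u ≥ s` such that `x` and `y`
lie in the same component of `L_{u,k}(X)`. -/
def dS {n : ℕ} (X : Finset (Pt n)) (k : ℕ) (s : ℝ) (x y : Pt n) : ℝ :=
  sInf {u : ℝ | s ≤ u ∧ SameComp X k u x y} - s

section Preorder

variable {n : ℕ} {X : Finset (Pt n)} {k : ℕ}

theorem IsLVertex.mono {s t : ℝ} (h : s ≤ t) {x : Pt n} (hx : IsLVertex X k s x) :
    IsLVertex X k t x := by
  obtain ⟨hX, S, hS, hxS, hk, hd⟩ := hx
  exact ⟨hX, S, hS, hxS, hk, fun y hy => (hd y hy).trans h⟩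

theorem SameComp.refl {s : ℝ} {x : Pt n} (hx : IsLVertex X k s x) : SameComp X k s x x :=
  ⟨hx, .refl⟩

theorem SameComp.trans {s : ℝ} {x y z : Pt n} (h : SameComp X k s x y)
    (h' : SameComp X k s y z) : SameComp X k s x z :=
  ⟨h.1, h.2.trans h'.2⟩

theorem SameComp.symm {s : ℝ} {x y : Pt n} (h : SameComp X k s x y) : SameComp X k s y x := by
  obtain ⟨hx, hxy⟩ := h
  induction hxy with
  | refl => exact .refl hx
  | tail _ hyz ih =>
    exact SameComp.trans ⟨hyz.1, .single ⟨ih.1, by rw [dist_comm]; exact hyz.2⟩⟩ ih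

theorem SameComp.mono {s t : ℝ} (hst : s ≤ t) {x y : Pt n} (h : SameComp X k s x y) :
    SameComp X k t x y :=
  ⟨h.1.mono hst,
    Relation.ReflTransGen.mono (fun _ _ hab => ⟨hab.1.mono hst, hab.2.trans hst⟩) _ _ h.2⟩

theorem GammaLe.trans {p q r : ℝ × Pt n} (h : GammaLe X k p q) (h' : GammaLe X k q r) :
    GammaLe X k p r :=
  ⟨h.1.trans h'.1, (h.2.mono h'.1).trans h'.2⟩

/-- Elements above a common element are ordered by their scale. -/
theorem GammaLe.of_common_lower {p q r : ℝ × Pt n} (hq : GammaLe X k p q)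
    (hr : GammaLe X k p r) (h : q.1 ≤ r.1) : GammaLe X k q r :=
  ⟨h, (hq.2.symm.mono h).trans hr.2⟩

theorem GammaLe.total_of_common_lower {p q r : ℝ × Pt n} (hq : GammaLe X k p q)
    (hr : GammaLe X k p r) : GammaLe X k q r ∨ GammaLe X k r q :=
  (le_total q.1 r.1).imp (hq.of_common_lower hr) (hr.of_common_lower hq)

theorem IsLUBIn.symm {a b c : ℝ × Pt n} (h : IsLUBIn X k a b c) : IsLUBIn X k b a c :=
  ⟨h.1, h.2.2.1, h.2.1, fun c' hc' hb ha => h.2.2.2 c' hc' ha hb⟩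

theorem IsLUBIn.le_right {a b c : ℝ × Pt n} (h : IsLUBIn X k a b c) (hb : InGamma X k b)
    (hab : GammaLe X k a b) : GammaLe X k c b :=
  h.2.2.2 b hb hab ⟨le_rfl, .refl hb.2⟩

theorem IsBranch.of_equiv {p q : ℝ × Pt n} (hp : IsBranch X k p) (hq : InGamma X k q)
    (hpq : GammaLe X k p q) (hqp : GammaLe X k q p) : IsBranch X k q := by
  have he : p.1 = q.1 := le_antisymm hpq.1 hqp.1
  refine ⟨hq, hp.2.imp ?_ ?_⟩
  · rintro ⟨s₀, hs₀, H⟩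
    refine ⟨s₀, he ▸ hs₀, fun s hs hsq => ?_⟩
    obtain ⟨x₀, x₁, h₀, h₁, hne, hl₀, hl₁⟩ := H s hs (he ▸ hsq)
    exact ⟨x₀, x₁, h₀, h₁, hne, hl₀.trans hpq, hl₁.trans hpq⟩
  · rintro H ⟨r, hr, hrΓ, hrq⟩
    exact H ⟨r, he ▸ hr, hrΓ, hrq.trans hqp⟩

/-- A least upper bound of incomparable elements is a branch point. -/
theorem IsLUBIn.isBranch_of_incomparable {a b m : ℝ × Pt n} (ha : InGamma X k a)
    (hb : InGamma X k b) (hm : IsLUBIn X k a b m) (hab : ¬ GammaLe X k a b)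
    (hba : ¬ GammaLe X k b a) : IsBranch X k m := by
  obtain ⟨hmΓ, ham, hbm, hleast⟩ := hm
  have ha_lt : a.1 < m.1 := lt_of_not_ge fun h =>
    hba (hbm.trans (ham.of_common_lower ⟨le_rfl, .refl ha.2⟩ h))
  have hb_lt : b.1 < m.1 := lt_of_not_ge fun h =>
    hab (ham.trans (hbm.of_common_lower ⟨le_rfl, .refl hb.2⟩ h))
  refine ⟨hmΓ, .inl ⟨max a.1 b.1, max_lt ha_lt hb_lt, fun s hs hsm => ?_⟩⟩
  have has := (le_max_left _ _).trans hs
  have hbs := (le_max_right _ _).trans hs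
  refine ⟨a.2, b.2, ha.2.mono has, hb.2.mono hbs, fun h => ?_, ⟨hsm.le, ham.2⟩,
    ⟨hsm.le, hbm.2⟩⟩
  have hms := hleast (s, a.2) ⟨ha.1.trans has, ha.2.mono has⟩
    ⟨has, .refl (ha.2.mono has)⟩ ⟨hbs, h.symm⟩
  exact hsm.not_ge hms.1

theorem IsLUBIn.isBranch {a b m : ℝ × Pt n} (hm : IsLUBIn X k a b m) (ha : IsBranch X k a)
    (hb : IsBranch X k b) : IsBranch X k m := by
  by_cases hab : GammaLe X k a b
  · exact hb.of_equiv hm.1 hm.2.2.1 (hm.le_right hb.1 hab)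
  by_cases hba : GammaLe X k b a
  · exact ha.of_equiv hm.1 hm.2.1 (hm.symm.le_right ha.1 hba)
  exact hm.isBranch_of_incomparable ha.1 hb.1 hab hba

end Preorder

theorem stmt13 {n : ℕ} (X : Finset (Pt n)) (k : ℕ) (hcard : k + 1 ≤ X.card)
    (a b a₀ b₀ m c : ℝ × Pt n)
    (ha : InGamma X k a) (hb : InGamma X k b)
    (ha₀ : IsMaxBranchBelow X k a₀ a) (hb₀ : IsMaxBranchBelow X k b₀ b)
    (hm : IsLUBIn X k a₀ b₀ m) (hc : IsLUBIn X k a b c) :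
    IsMaxBranchBelow X k m c := by
  have hmc : GammaLe X k m c :=
    hm.2.2.2 c hc.1 (ha₀.2.1.trans hc.2.1) (hb₀.2.1.trans hc.2.2.1)
  refine ⟨hm.isBranch ha₀.1 hb₀.1, hmc, fun d hd hdc => ?_⟩
  by_cases hab : GammaLe X k a b
  · exact (hb₀.2.2 d hd (hdc.trans (hc.le_right hb hab))).trans hm.2.2.1
  by_cases hba : GammaLe X k b a
  · exact (ha₀.2.2 d hd (hdc.trans (hc.symm.le_right ha hba))).trans hm.2.1
  have ham : GammaLe X k a m :=
    (hm.2.1.total_of_common_lower ha₀.2.1).resolve_left fun hma =>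
      ((hm.2.2.1.trans hma).total_of_common_lower hb₀.2.1).elim hab hba
  have hbm : GammaLe X k b m :=
    (hm.2.2.1.total_of_common_lower hb₀.2.1).resolve_left fun hmb =>
      ((hm.2.1.trans hmb).total_of_common_lower ha₀.2.1).elim hba hab
  exact hdc.trans (hc.2.2.2 m hm.1 ham hbm)

end DataHomotopy
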